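/- Let g : [0,∞) → ℝ be continuous with g(0) = 0, let κ ∈ ℝ, let 0 ≤ t₁ < t₂, and define κ_t := κ for t₁ < t ≤ t₂ and κ_t := 0 otherwise. Suppose y : [0,∞) → ℝ is continuous and satisfies the integral equation y_t = ∫_0^t κ_u y_u du + g_t for all t ≥ 0. Then: (i) y_t = g_t for all 0 ≤ t ≤ t₁; (ii) y_t = e^{κ(t−t₁)} g_{t₁} + (g_t − g_{t₁}) + κ ∫_{t₁}^{t} e^{κ(t−u)} (g_u − g_{t₁}) du for all t₁ < t ≤ t₂; and (iii) y_t = y_{t₂} + (g_t − g_{t₂}) for all t > t₂. -/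

import Mathlib

open Set intervalIntegral MeasureTheory in
/-- Variation of constants for the linear Volterra equation
`y s = c + κ * ∫ u in a..s, y u + h s`, with the forcing term `h` only continuous. -/
theorem volterra_variation_of_constants {κ a t c : ℝ} {h y : ℝ → ℝ} (hat : a ≤ t)
    (hh : ContinuousOn h (Icc a t)) (hy : ContinuousOn y (Icc a t))
    (heq : ∀ s ∈ Icc a t, y s = c + κ * (∫ u in a..s, y u) + h s) :
    y t = Real.exp (κ * (t - a)) * c + h t +
      κ * ∫ u in a..t, Real.exp (κ * (t - u)) * h u := by
  have hexp : Continuous fun s : ℝ => Real.exp (κ * (t - s)) := by fun_prop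
  have hyi : IntervalIntegrable y volume a t := hy.intervalIntegrable_of_Icc hat
  have hprim : ContinuousOn (fun s => ∫ u in a..s, y u) (Icc a t) := by
    simpa [uIcc_of_le hat] using continuousOn_primitive_interval' hyi left_mem_uIcc
  have hderiv : ∀ s ∈ Ioo a t,
      HasDerivAt (fun s => Real.exp (κ * (t - s)) * (κ * (∫ u in a..s, y u) + c))
        (κ * (Real.exp (κ * (t - s)) * h s)) s := by
    intro s hs
    have hz : HasDerivAt (fun s => ∫ u in a..s, y u) (y s) s :=
      integral_hasDerivAt_right
        ((hy.mono (Icc_subset_Icc_right hs.2.le)).intervalIntegrable_of_Icc hs.1.le)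
        ((hy.mono Ioo_subset_Icc_self).stronglyMeasurableAtFilter isOpen_Ioo s hs)
        (hy.continuousAt (Icc_mem_nhds hs.1 hs.2))
    have he : HasDerivAt (fun s : ℝ => Real.exp (κ * (t - s)))
        (Real.exp (κ * (t - s)) * (κ * -1)) s :=
      (((hasDerivAt_id s).const_sub t).const_mul κ).exp
    refine (he.mul ((hz.const_mul κ).add_const c)).congr_deriv ?_
    rw [heq s (Ioo_subset_Icc_self hs)]
    ring
  have hftc := integral_eq_sub_of_hasDerivAt_of_le hat
    (hexp.continuousOn.mul ((hprim.const_smul κ).add continuousOn_const)) hderiv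
    (((hexp.continuousOn.mul hh).const_smul κ).intervalIntegrable_of_Icc hat)
  rw [intervalIntegral.integral_const_mul] at hftc
  rw [hftc, heq t (right_mem_Icc.2 hat)]
  simp
  ring

/-- pathwise solution of the linear Volterra equation
`y_t = ∫_0^t κ_u y_u du + g_t` with a piecewise-constant coefficient
that equals `κ` on `(t₁, t₂]` and `0` elsewhere. -/
theorem stmt_12 (κ t₁ t₂ : ℝ) (ht₁ : 0 ≤ t₁) (ht₁₂ : t₁ < t₂)
    (g y : ℝ → ℝ) (hg : ContinuousOn g (Set.Ici 0)) (hg0 : g 0 = 0)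
    (hy : ContinuousOn y (Set.Ici 0))
    (heq : ∀ t : ℝ, 0 ≤ t →
      y t = (∫ u in (0:ℝ)..t, (if t₁ < u ∧ u ≤ t₂ then κ else 0) * y u) + g t) :
    (∀ t : ℝ, 0 ≤ t → t ≤ t₁ → y t = g t) ∧
    (∀ t : ℝ, t₁ < t → t ≤ t₂ →
      y t = Real.exp (κ * (t - t₁)) * g t₁ + (g t - g t₁) +
        κ * ∫ u in t₁..t, Real.exp (κ * (t - u)) * (g u - g t₁)) ∧
    (∀ t : ℝ, t₂ < t → y t = y t₂ + (g t - g t₂)) := by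
  have hcoef : ∀ {a b c : ℝ}, 0 ≤ a → a ≤ b →
      (∀ u ∈ Set.Ioc a b, (if t₁ < u ∧ u ≤ t₂ then κ else 0) = c) →
      IntervalIntegrable (fun u => (if t₁ < u ∧ u ≤ t₂ then κ else 0) * y u)
        MeasureTheory.volume a b ∧
      ∫ u in a..b, (if t₁ < u ∧ u ≤ t₂ then κ else 0) * y u = c * ∫ u in a..b, y u := by
    intro a b c ha hab hc
    have hyi : IntervalIntegrable y MeasureTheory.volume a b :=
      (hy.mono fun u hu => ha.trans hu.1).intervalIntegrable_of_Icc hab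
    have hcongr : Set.EqOn (fun u => c * y u)
        (fun u => (if t₁ < u ∧ u ≤ t₂ then κ else 0) * y u) (Set.uIoc a b) := by
      intro u hu
      simp only [hc u (Set.uIoc_of_le hab ▸ hu)]
    refine ⟨(hyi.const_mul c).congr hcongr, ?_⟩
    rw [← intervalIntegral.integral_const_mul]
    exact intervalIntegral.integral_congr_ae (.of_forall fun u hu => (hcongr hu).symm)
  have hbefore : ∀ t, 0 ≤ t → t ≤ t₁ →
      IntervalIntegrable (fun u => (if t₁ < u ∧ u ≤ t₂ then κ else 0) * y u)
        MeasureTheory.volume 0 t ∧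
      ∫ u in (0:ℝ)..t, (if t₁ < u ∧ u ≤ t₂ then κ else 0) * y u = 0 * ∫ u in (0:ℝ)..t, y u :=
    fun t h0 ht => hcoef le_rfl h0 fun u hu => if_neg fun h => (hu.2.trans ht).not_gt h.1
  have hduring : ∀ t, t₁ ≤ t → t ≤ t₂ →
      IntervalIntegrable (fun u => (if t₁ < u ∧ u ≤ t₂ then κ else 0) * y u)
        MeasureTheory.volume t₁ t ∧
      ∫ u in t₁..t, (if t₁ < u ∧ u ≤ t₂ then κ else 0) * y u = κ * ∫ u in t₁..t, y u :=
    fun t h₁ h₂ => hcoef ht₁ h₁ fun u hu => if_pos ⟨hu.1, hu.2.trans h₂⟩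
  refine ⟨fun t h0 ht => ?_, fun t h₁ h₂ => ?_, fun t ht => ?_⟩
  · rw [heq t h0, (hbefore t h0 ht).2, zero_mul, zero_add]
  · have hsub : Set.Icc t₁ t ⊆ Set.Ici 0 := fun u hu => ht₁.trans hu.1
    refine volterra_variation_of_constants (h := fun u => g u - g t₁) h₁.le
      ((hg.mono hsub).sub continuousOn_const) (hy.mono hsub) fun s hs => ?_
    have hb := hbefore t₁ ht₁ le_rfl
    have hd := hduring s hs.1 (hs.2.trans h₂)
    rw [heq s (hsub hs), ← intervalIntegral.integral_add_adjacent_intervals hb.1 hd.1,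
      hb.2, hd.2]
    ring
  · have h0 : 0 ≤ t₂ := ht₁.trans ht₁₂.le
    have hafter := hcoef (c := 0) h0 ht.le fun u hu => if_neg fun h => hu.1.not_ge h.2
    have hi := (hbefore t₁ ht₁ le_rfl).1.trans (hduring t₂ ht₁₂.le le_rfl).1
    rw [heq t (h0.trans ht.le), heq t₂ h0,
      ← intervalIntegral.integral_add_adjacent_intervals hi hafter.1, hafter.2]
    ring
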